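/- Let E ⊆ ℂ be open, f : E → ℂ holomorphic, m, n ≥ 0, and z_0,…,z_{m+n} ∈ E arbitrary nodes (repetitions allowed). Then there exist complex polynomials p and q with deg p ≤ m, deg q ≤ n, q ≢ 0, and a holomorphic function ṽ : E → ℂ such that p(z) − q(z)·f(z) = ṽ(z)·∏_{j=0}^{m+n}(z − z_j) for all z ∈ E. -/

import Mathlib

open Polynomial Set

/-- Hermite interpolation: a holomorphic function on an open set agrees with some polynomial
modulo `∏ j, (z - x j)`, with holomorphic quotient. -/
theorem DifferentiableOn.exists_hermite_interpolation {E : Set ℂ} (hE : IsOpen E) {f : ℂ → ℂ}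
    (hf : DifferentiableOn ℂ f E) {k : ℕ} (x : Fin k → ℂ) (hx : ∀ j, x j ∈ E) :
    ∃ P : ℂ[X], ∃ w : ℂ → ℂ, DifferentiableOn ℂ w E ∧
      ∀ z, f z = P.eval z + w z * ∏ j, (z - x j) := by
  induction k with
  | zero => exact ⟨0, f, hf, by simp⟩
  | succ k ih =>
    obtain ⟨P, w, hw, h⟩ := ih (fun j => x j.castSucc) fun j => hx _
    set a := x (Fin.last k) with ha
    refine ⟨P + C (w a) * ∏ j : Fin k, (X - C (x j.castSucc)), dslope w a,
      (Complex.differentiableOn_dslope (hE.mem_nhds (hx _))).2 hw, fun z => ?_⟩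
    have hs : (z - a) * dslope w a z = w z - w a := sub_smul_dslope w a z
    rw [h z, Fin.prod_univ_castSucc, ← ha]
    simp only [eval_add, eval_mul, eval_C, eval_prod, eval_sub, eval_X]
    linear_combination (-∏ j : Fin k, (z - x j.castSucc)) * hs

/-- Linearized rational interpolation modulo a monic polynomial of degree `m + n + 1`. -/
theorem Polynomial.exists_natDegree_mul_modByMonic_le {K : Type*} [Field K] (P : K[X]) {W : K[X]}
    (hW : W.Monic) {m n : ℕ} (hdeg : W.natDegree = m + n + 1) :
    ∃ q : K[X], q.natDegree ≤ n ∧ q ≠ 0 ∧ ((q * P) %ₘ W).natDegree ≤ m := by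
  let F : degreeLT K (n + 1) →ₗ[K] (Fin n → K) := LinearMap.pi fun i =>
    lcoeff K (m + 1 + i) ∘ₗ modByMonicHom W ∘ₗ LinearMap.mulRight K P ∘ₗ
      (degreeLT K (n + 1)).subtype
  have : FiniteDimensional K (degreeLT K (n + 1)) :=
    (degreeLT.basis K (n + 1)).finiteDimensional_of_finite
  have hF : LinearMap.ker F ≠ ⊥ := by
    apply LinearMap.ker_ne_bot_of_finrank_lt
    rw [(degreeLTEquiv K (n + 1)).finrank_eq]
    simp
  obtain ⟨⟨q, hq⟩, hker, hne⟩ := (Submodule.ne_bot_iff _).1 hF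
  refine ⟨q, ?_, fun h => hne (Subtype.ext h), ?_⟩
  · rw [mem_degreeLT] at hq
    exact Nat.lt_succ_iff.1 ((natDegree_lt_iff_degree_lt fun h => hne (Subtype.ext h)).2 hq)
  · rw [natDegree_le_iff_coeff_eq_zero]
    intro N hN
    by_cases hNn : N < m + n + 1
    · have := congrFun (LinearMap.mem_ker.1 hker) ⟨N - (m + 1), by omega⟩
      simpa [F, show m + 1 + (N - (m + 1)) = N by omega] using this
    · apply coeff_eq_zero_of_natDegree_lt
      have := natDegree_modByMonic_lt (q * P) hW (by rintro rfl; simp at hdeg)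
      omega

/-- Existence of solutions to the linearized rational interpolation (Newton–Padé)
problem: for any degrees `m, n` and any nodes `z₀,…,z_{m+n}` in an open set `E` on which
`f` is holomorphic, there exist polynomials `p, q` with `deg p ≤ m`, `deg q ≤ n`,
`q ≢ 0`, and a holomorphic `ṽ : E → ℂ` with
`p(z) − q(z)·f(z) = ṽ(z)·∏_{j=0}^{m+n}(z − z_j)` on `E`. -/
theorem newton_pade_exists
    (E : Set ℂ) (hE : IsOpen E) (f : ℂ → ℂ) (hf : DifferentiableOn ℂ f E)
    (m n : ℕ) (nodes : Fin (m + n + 1) → ℂ) (hnodes : ∀ j, nodes j ∈ E) :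
    ∃ p q : Polynomial ℂ, ∃ v : ℂ → ℂ,
      p.natDegree ≤ m ∧ q.natDegree ≤ n ∧ q ≠ 0 ∧
      DifferentiableOn ℂ v E ∧
      ∀ z ∈ E, p.eval z - q.eval z * f z = v z * ∏ j, (z - nodes j) := by
  obtain ⟨P, w, hw, hfP⟩ := hf.exists_hermite_interpolation hE nodes hnodes
  have hW : (∏ j, (X - C (nodes j))).Monic := monic_prod_X_sub_C nodes Finset.univ
  obtain ⟨q, hqn, hq0, hp⟩ := exists_natDegree_mul_modByMonic_le P hW (m := m) (n := n)
    (by simp [natDegree_finsetProd_X_sub_C_eq_card])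
  refine ⟨_, q, fun z => -((q * P) /ₘ ∏ j, (X - C (nodes j))).eval z - q.eval z * w z, hp, hqn, hq0,
    (Polynomial.differentiableOn _).neg.sub (q.differentiableOn.mul hw), fun z _ => ?_⟩
  have h := congrArg (eval z) (modByMonic_add_div (q * P) (∏ j, (X - C (nodes j))))
  have hWz : (∏ j, (X - C (nodes j))).eval z = ∏ j, (z - nodes j) := by simp [eval_prod]
  rw [eval_add, eval_mul, eval_mul, hWz] at h
  rw [hfP z]
  linear_combination h
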